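/- Assume cᵢ ≥ 0 and ℓᵢ > 0 for i = 1,2,3, the ordering condition (Ω′), c₁/ℓ₁ < 1, and c₂/ℓ₂ ≥ 1. Then Vol₄(P_H(c,ℓ)) = (8/3)·ℓ₁²ℓ₂²ℓ₃²·(2c₂/ℓ₂ + 2c₃/ℓ₃ + 1). -/

import Mathlib

open MeasureTheory

/-- The convex hull of the graph of the trilinear monomial `x₁x₂x₃` over the box
`[c₁-ℓ₁, c₁+ℓ₁] × [c₂-ℓ₂, c₂+ℓ₂] × [c₃-ℓ₃, c₃+ℓ₃]`, viewed in `ℝ⁴`. -/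
noncomputable def PH (c₁ c₂ c₃ ℓ₁ ℓ₂ ℓ₃ : ℝ) : Set (Fin 4 → ℝ) :=
  convexHull ℝ {p : Fin 4 → ℝ | ∃ x₁ x₂ x₃ : ℝ,
    x₁ ∈ Set.Icc (c₁ - ℓ₁) (c₁ + ℓ₁) ∧ x₂ ∈ Set.Icc (c₂ - ℓ₂) (c₂ + ℓ₂) ∧
    x₃ ∈ Set.Icc (c₃ - ℓ₃) (c₃ + ℓ₃) ∧ p = ![x₁ * x₂ * x₃, x₁, x₂, x₃]}

/-- The multilinear normal form of `x₁x₂x₃` on the unit cube. -/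
def cubeMonomial (p q r x y z : ℝ) : ℝ :=
  2 * (x * y * z) - r * (y * z) + p * (x * z) + q * (x * y)

/-- The concave envelope of `cubeMonomial` over the unit cube, for `0 ≤ p`, `0 ≤ q` and
`0 ≤ r ≤ 2`. -/
noncomputable def cubeUpper (p q r x y z : ℝ) : ℝ :=
  q * min x y + p * min x z + (2 - r) * min x (min y z) + r * min 0 (x - y - z + 1)

/-- The convex envelope of `cubeMonomial` over the unit cube, for `0 ≤ p`, `0 ≤ q` and
`0 ≤ r ≤ 2`. -/
noncomputable def cubeLower (p q r x y z : ℝ) : ℝ :=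
  p * z + q * y - cubeUpper p q (2 - r) (1 - x) y z

lemma cubeMonomial_reflect (p q r x y z : ℝ) :
    cubeMonomial p q (2 - r) (1 - x) y z = p * z + q * y - cubeMonomial p q r x y z := by
  unfold cubeMonomial; ring

lemma cubeMonomial_le_cubeUpper {p q r x y z : ℝ} (hp : 0 ≤ p) (hq : 0 ≤ q) (hr : 0 ≤ r)
    (hr' : r ≤ 2) (hx : x ∈ Set.Icc (0 : ℝ) 1) (hy : y ∈ Set.Icc (0 : ℝ) 1)
    (hz : z ∈ Set.Icc (0 : ℝ) 1) : cubeMonomial p q r x y z ≤ cubeUpper p q r x y z := by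
  obtain ⟨hx0, hx1⟩ := hx
  obtain ⟨hy0, hy1⟩ := hy
  obtain ⟨hz0, hz1⟩ := hz
  have hxy : x * y ≤ min x y := le_min (by nlinarith) (by nlinarith)
  have hxz : x * z ≤ min x z := le_min (by nlinarith) (by nlinarith)
  have hyz : y * z ≤ min y z := le_min (by nlinarith) (by nlinarith)
  have hyz0 : 0 ≤ y * z := mul_nonneg hy0 hz0
  have hyz1 : y * z ≤ 1 := by nlinarith
  have hxyz : x * y * z ≤ min x (min y z) := by
    refine le_min (by nlinarith) (le_trans ?_ hyz)
    nlinarith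
  have h0 : x * y * z - y * z ≤ min 0 (x - y - z + 1) := by
    refine le_min (by nlinarith) ?_
    nlinarith [mul_nonneg (sub_nonneg.2 hy1) (sub_nonneg.2 hz1),
      mul_nonneg hx0 (sub_nonneg.2 hyz1)]
  have e : cubeMonomial p q r x y z = q * (x * y) + p * (x * z) + (2 - r) * (x * y * z)
      + r * (x * y * z - y * z) := by unfold cubeMonomial; ring
  rw [e, cubeUpper]
  have := sub_nonneg.2 hr'
  gcongr

lemma cubeLower_le_cubeMonomial {p q r x y z : ℝ} (hp : 0 ≤ p) (hq : 0 ≤ q) (hr : 0 ≤ r)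
    (hr' : r ≤ 2) (hx : x ∈ Set.Icc (0 : ℝ) 1) (hy : y ∈ Set.Icc (0 : ℝ) 1)
    (hz : z ∈ Set.Icc (0 : ℝ) 1) : cubeLower p q r x y z ≤ cubeMonomial p q r x y z := by
  have := cubeMonomial_le_cubeUpper hp hq (sub_nonneg.2 hr') (sub_le_self 2 hr)
    (x := 1 - x) ⟨by linarith [hx.2], by linarith [hx.1]⟩ hy hz
  rw [cubeMonomial_reflect] at this
  unfold cubeLower
  linarith

/-- The graph of `cubeMonomial` over the unit cube. -/
def cubeGraph (p q r : ℝ) : Set (Fin 4 → ℝ) :=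
  {v | ∃ x y z : ℝ, x ∈ Set.Icc (0 : ℝ) 1 ∧ y ∈ Set.Icc (0 : ℝ) 1 ∧ z ∈ Set.Icc (0 : ℝ) 1 ∧
    v = ![cubeMonomial p q r x y z, x, y, z]}

/-- The region between `cubeLower` and `cubeUpper` over the unit cube. -/
def cubeRegion (p q r : ℝ) : Set (Fin 4 → ℝ) :=
  {v | v 1 ∈ Set.Icc (0 : ℝ) 1 ∧ v 2 ∈ Set.Icc (0 : ℝ) 1 ∧ v 3 ∈ Set.Icc (0 : ℝ) 1 ∧
    v 0 ∈ Set.Icc (cubeLower p q r (v 1) (v 2) (v 3)) (cubeUpper p q r (v 1) (v 2) (v 3))}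

lemma min_combo_le {a b s t s' t' : ℝ} (ha : 0 ≤ a) (hb : 0 ≤ b) :
    a * min s t + b * min s' t' ≤ min (a * s + b * s') (a * t + b * t') := by
  rw [mul_min_of_nonneg _ _ ha, mul_min_of_nonneg _ _ hb]
  exact min_add_min_le_min_add_add

lemma cubeUpper_combo_le {p q r a b x y z x' y' z' : ℝ} (hp : 0 ≤ p) (hq : 0 ≤ q) (hr : 0 ≤ r)
    (hr' : r ≤ 2) (ha : 0 ≤ a) (hb : 0 ≤ b) (hab : a + b = 1) :
    a * cubeUpper p q r x y z + b * cubeUpper p q r x' y' z' ≤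
      cubeUpper p q r (a * x + b * x') (a * y + b * y') (a * z + b * z') := by
  have h1 := min_combo_le (s := x) (t := y) (s' := x') (t' := y') ha hb
  have h2 := min_combo_le (s := x) (t := z) (s' := x') (t' := z') ha hb
  have h3 := (min_combo_le (s := x) (t := min y z) (s' := x') (t' := min y' z') ha hb).trans
    (min_le_min_left _ (min_combo_le ha hb))
  have h4 := min_combo_le (s := 0) (t := x - y - z + 1) (s' := 0) (t' := x' - y' - z' + 1) ha hb
  have e : a * (x - y - z + 1) + b * (x' - y' - z' + 1) =
      (a * x + b * x') - (a * y + b * y') - (a * z + b * z') + 1 := by linear_combination hab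
  rw [e, mul_zero, mul_zero, add_zero] at h4
  unfold cubeUpper
  linarith [mul_le_mul_of_nonneg_left h1 hq, mul_le_mul_of_nonneg_left h2 hp,
    mul_le_mul_of_nonneg_left h3 (sub_nonneg.2 hr'), mul_le_mul_of_nonneg_left h4 hr]

lemma convex_cubeRegion {p q r : ℝ} (hp : 0 ≤ p) (hq : 0 ≤ q) (hr : 0 ≤ r) (hr' : r ≤ 2) :
    Convex ℝ (cubeRegion p q r) := by
  rintro v ⟨h1, h2, h3, h0⟩ w ⟨k1, k2, k3, k0⟩ a b ha hb hab
  have hI := convex_Icc (𝕜 := ℝ) (0 : ℝ) 1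
  refine ⟨hI h1 k1 ha hb hab, hI h2 k2 ha hb hab, hI h3 k3 ha hb hab, ?_, ?_⟩
  · have h := cubeUpper_combo_le (x := 1 - v 1) (y := v 2) (z := v 3) (x' := 1 - w 1)
      (y' := w 2) (z' := w 3) hp hq (sub_nonneg.2 hr') (sub_le_self 2 hr) ha hb hab
    have e : a * (1 - v 1) + b * (1 - w 1) = 1 - (a * v 1 + b * w 1) := by
      linear_combination hab
    have hv := mul_le_mul_of_nonneg_left h0.1 ha
    have hw := mul_le_mul_of_nonneg_left k0.1 hb
    rw [e] at h
    simp only [Pi.add_apply, Pi.smul_apply, smul_eq_mul, cubeLower] at hv hw ⊢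
    linarith
  · have h := cubeUpper_combo_le (x := v 1) (y := v 2) (z := v 3) (x' := w 1)
      (y' := w 2) (z' := w 3) hp hq hr hr' ha hb hab
    have hv := mul_le_mul_of_nonneg_left h0.2 ha
    have hw := mul_le_mul_of_nonneg_left k0.2 hb
    simp only [Pi.add_apply, Pi.smul_apply, smul_eq_mul]
    linarith

lemma Convex.combo_four_mem {E : Type*} [AddCommGroup E] [Module ℝ E] {S : Set E}
    (hS : Convex ℝ S) {u₁ u₂ u₃ u₄ : E} (h₁ : u₁ ∈ S) (h₂ : u₂ ∈ S) (h₃ : u₃ ∈ S) (h₄ : u₄ ∈ S)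
    {a b c d : ℝ} (ha : 0 ≤ a) (hb : 0 ≤ b) (hc : 0 ≤ c) (hd : 0 ≤ d) (h : a + b + c + d = 1) :
    a • u₁ + b • u₂ + c • u₃ + d • u₄ ∈ S := by
  have := hS.sum_mem (t := Finset.univ) (w := ![a, b, c, d]) (z := ![u₁, u₂, u₃, u₄])
    (by intro i _; fin_cases i <;> assumption) (by simpa [Fin.sum_univ_four] using h)
    (by intro i _; fin_cases i <;> assumption)
  simpa [Fin.sum_univ_four] using this

lemma cubeUpper_mem {p q r x y z : ℝ} {S : Set (Fin 4 → ℝ)} (hS : Convex ℝ S)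
    (hF : cubeGraph p q r ⊆ S) (hx : x ∈ Set.Icc (0 : ℝ) 1) (hy : y ∈ Set.Icc (0 : ℝ) 1)
    (hz : z ∈ Set.Icc (0 : ℝ) 1) : ![cubeUpper p q r x y z, x, y, z] ∈ S := by
  have mem0 : (0 : ℝ) ∈ Set.Icc (0 : ℝ) 1 := by simp
  have mem1 : (1 : ℝ) ∈ Set.Icc (0 : ℝ) 1 := by simp
  have v000 : ![0, 0, 0, 0] ∈ S :=
    hF ⟨0, 0, 0, mem0, mem0, mem0, by simp [cubeMonomial]⟩
  have v100 : ![0, 1, 0, 0] ∈ S :=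
    hF ⟨1, 0, 0, mem1, mem0, mem0, by simp [cubeMonomial]⟩
  have v010 : ![0, 0, 1, 0] ∈ S :=
    hF ⟨0, 1, 0, mem0, mem1, mem0, by simp [cubeMonomial]⟩
  have v001 : ![0, 0, 0, 1] ∈ S :=
    hF ⟨0, 0, 1, mem0, mem0, mem1, by simp [cubeMonomial]⟩
  have v110 : ![q, 1, 1, 0] ∈ S :=
    hF ⟨1, 1, 0, mem1, mem1, mem0, by simp [cubeMonomial]⟩
  have v101 : ![p, 1, 0, 1] ∈ S :=
    hF ⟨1, 0, 1, mem1, mem0, mem1, by simp [cubeMonomial]⟩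
  have v011 : ![-r, 0, 1, 1] ∈ S :=
    hF ⟨0, 1, 1, mem0, mem1, mem1, by simp [cubeMonomial]⟩
  have v111 : ![2 - r + p + q, 1, 1, 1] ∈ S :=
    hF ⟨1, 1, 1, mem1, mem1, mem1, by simp [cubeMonomial]⟩
  obtain ⟨hx0, hx1⟩ := hx
  obtain ⟨hy0, hy1⟩ := hy
  obtain ⟨hz0, hz1⟩ := hz
  unfold cubeUpper
  rcases le_total x y with hxy | hxy <;> rcases le_total x z with hxz | hxz
  · rw [min_eq_left hxy, min_eq_left hxz, min_eq_left (le_min hxy hxz)]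
    rcases le_total (y + z - 1) x with h | h
    · rw [min_eq_left (by linarith)]
      convert hS.combo_four_mem v111 v010 v001 v000 hx0 (sub_nonneg.2 hxy) (sub_nonneg.2 hxz)
        (d := 1 - y - z + x) (by linarith) (by ring) using 1
      ext i; fin_cases i <;> (simp; try ring)
    · rw [min_eq_right (by linarith)]
      convert hS.combo_four_mem v111 v010 v001 v011 hx0 (sub_nonneg.2 hz1) (sub_nonneg.2 hy1)
        (d := y + z - 1 - x) (by linarith) (by ring) using 1
      ext i; fin_cases i <;> (simp; try ring)
  · rw [min_eq_left hxy, min_eq_right hxz, min_eq_right (hxz.trans hxy),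
      min_eq_right hxz, min_eq_left (by linarith)]
    convert hS.combo_four_mem v111 v110 v010 v000 hz0 (sub_nonneg.2 hxz) (sub_nonneg.2 hxy)
      (sub_nonneg.2 hy1) (by ring) using 1
    ext i; fin_cases i <;> (simp; try ring)
  · rw [min_eq_right hxy, min_eq_left hxz, min_eq_left (hxy.trans hxz),
      min_eq_right hxy, min_eq_left (by linarith)]
    convert hS.combo_four_mem v111 v101 v001 v000 hy0 (sub_nonneg.2 hxy) (sub_nonneg.2 hxz)
      (sub_nonneg.2 hz1) (by ring) using 1
    ext i; fin_cases i <;> (simp; try ring)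
  · rw [min_eq_right hxy, min_eq_right hxz, min_eq_right ((min_le_left y z).trans hxy),
      min_eq_left (a := 0) (by linarith)]
    rcases le_total y z with hyz | hyz
    · rw [min_eq_left hyz]
      convert hS.combo_four_mem v111 v101 v100 v000 hy0 (sub_nonneg.2 hyz) (sub_nonneg.2 hxz)
        (sub_nonneg.2 hx1) (by ring) using 1
      ext i; fin_cases i <;> (simp; try ring)
    · rw [min_eq_right hyz]
      convert hS.combo_four_mem v111 v110 v100 v000 hz0 (sub_nonneg.2 hyz) (sub_nonneg.2 hxy)
        (sub_nonneg.2 hx1) (by ring) using 1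
      ext i; fin_cases i <;> (simp; try ring)

lemma cubeLower_mem {p q r x y z : ℝ} {S : Set (Fin 4 → ℝ)} (hS : Convex ℝ S)
    (hF : cubeGraph p q r ⊆ S) (hx : x ∈ Set.Icc (0 : ℝ) 1) (hy : y ∈ Set.Icc (0 : ℝ) 1)
    (hz : z ∈ Set.Icc (0 : ℝ) 1) : ![cubeLower p q r x y z, x, y, z] ∈ S := by
  let T : Set (Fin 4 → ℝ) :=
    {v | ![p * v 3 + q * v 2 - v 0, 1 - v 1, v 2, v 3] ∈ S}
  have hT : Convex ℝ T := by
    intro v hv w hw a b ha hb hab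
    have := hS hv hw ha hb hab
    change _ ∈ S
    convert this using 1
    ext i; fin_cases i <;> simp
    · ring
    · linear_combination -hab
  have hFT : cubeGraph p q (2 - r) ⊆ T := by
    rintro v ⟨x, y, z, hx, hy, hz, rfl⟩
    refine hF ⟨1 - x, y, z, ⟨by linarith [hx.2], by linarith [hx.1]⟩, hy, hz, ?_⟩
    have := cubeMonomial_reflect p q r (1 - x) y z
    rw [sub_sub_cancel] at this
    ext i; fin_cases i <;> simp [this]
  have := cubeUpper_mem (x := 1 - x) hT hFT ⟨by linarith [hx.2], by linarith [hx.1]⟩ hy hz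
  simpa [T, cubeLower] using this

lemma convexHull_cubeGraph {p q r : ℝ} (hp : 0 ≤ p) (hq : 0 ≤ q) (hr : 0 ≤ r) (hr' : r ≤ 2) :
    convexHull ℝ (cubeGraph p q r) = cubeRegion p q r := by
  refine (convexHull_min ?_ (convex_cubeRegion hp hq hr hr')).antisymm ?_
  · rintro v ⟨x, y, z, hx, hy, hz, rfl⟩
    exact ⟨hx, hy, hz, cubeLower_le_cubeMonomial hp hq hr hr' hx hy hz,
      cubeMonomial_le_cubeUpper hp hq hr hr' hx hy hz⟩
  · rintro v ⟨hx, hy, hz, h⟩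
    have hS := convex_convexHull ℝ (cubeGraph p q r)
    have hF := subset_convexHull ℝ (cubeGraph p q r)
    obtain ⟨a, b, ha, hb, hab, e⟩ := (Convex.mem_Icc (h.1.trans h.2)).1 h
    convert hS (cubeLower_mem hS hF hx hy hz) (cubeUpper_mem hS hF hx hy hz) ha hb hab using 1
    ext i
    fin_cases i
    · simpa using e.symm
    · simp [← add_mul, hab]
    · simp [← add_mul, hab]
    · simp [← add_mul, hab]

lemma setIntegral_cube_succ {n : ℕ} {f : (Fin (n + 1) → ℝ) → ℝ} (hf : Continuous f) :
    ∫ v in Set.Icc (0 : Fin (n + 1) → ℝ) 1, f v =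
      ∫ t in (0 : ℝ)..1, ∫ w in Set.Icc (0 : Fin n → ℝ) 1, f (Fin.cons t w) := by
  have e := (volume_preserving_piFinSuccAbove (fun _ : Fin (n + 1) => ℝ) 0).symm
  have hpre : (MeasurableEquiv.piFinSuccAbove (fun _ : Fin (n + 1) => ℝ) 0).symm ⁻¹'
      Set.Icc 0 1 = Set.Icc (0 : ℝ) 1 ×ˢ Set.Icc (0 : Fin n → ℝ) 1 := by
    ext ⟨t, w⟩
    simp [MeasurableEquiv.piFinSuccAbove, Fin.insertNthEquiv, Pi.le_def, Fin.forall_fin_succ]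
  have hcons : Continuous fun u : ℝ × (Fin n → ℝ) => f (Fin.cons u.1 u.2) :=
    hf.comp (by fun_prop)
  rw [← e.setIntegral_preimage_emb (MeasurableEquiv.measurableEmbedding _), hpre,
    intervalIntegral.integral_of_le zero_le_one, ← integral_Icc_eq_integral_Ioc,
    ← setIntegral_prod (fun u : ℝ × (Fin n → ℝ) => f (Fin.cons u.1 u.2))
      (hcons.continuousOn.integrableOn_compact (isCompact_Icc.prod isCompact_Icc)),
    ← Measure.volume_eq_prod]
  congr! 2 with u
  simp [MeasurableEquiv.piFinSuccAbove, Fin.insertNthEquiv]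

lemma setIntegral_cube_three {f : (Fin 3 → ℝ) → ℝ} (hf : Continuous f) :
    ∫ v in Set.Icc (0 : Fin 3 → ℝ) 1, f v =
      ∫ x in (0 : ℝ)..1, ∫ y in (0 : ℝ)..1, ∫ z in (0 : ℝ)..1, f ![x, y, z] := by
  rw [setIntegral_cube_succ hf]
  congr! 2 with x
  rw [setIntegral_cube_succ (f := fun w => f (Fin.cons x w)) (hf.comp (by fun_prop))]
  congr! 2 with y
  rw [setIntegral_cube_succ (f := fun w => f (Fin.cons x (Fin.cons y w)))
    (hf.comp (by fun_prop))]
  congr! 2 with z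
  rw [volume_pi, Measure.pi_of_empty (x := ![]),
    Set.eq_univ_of_forall (s := Set.Icc (0 : Fin 0 → ℝ) 1) fun w => by simp [Subsingleton.elim w 0],
    Measure.restrict_univ, integral_dirac]
  rfl

lemma integral_cubic (a b c d u v : ℝ) :
    ∫ t in u..v, (a + b * t + c * t ^ 2 + d * t ^ 3) =
      a * (v - u) + b * (v ^ 2 - u ^ 2) / 2 + c * (v ^ 3 - u ^ 3) / 3 + d * (v ^ 4 - u ^ 4) / 4 := by
  have h (t : ℝ) : HasDerivAt
      (fun t : ℝ => a * t + b / 2 * t ^ 2 + c / 3 * t ^ 3 + d / 4 * t ^ 4)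
      (a + b * t + c * t ^ 2 + d * t ^ 3) t := by
    refine ((((hasDerivAt_id t).const_mul a).add ((hasDerivAt_pow 2 t).const_mul (b / 2))).add
      ((hasDerivAt_pow 3 t).const_mul (c / 3))).add ((hasDerivAt_pow 4 t).const_mul (d / 4))
      |>.congr_deriv ?_
    push_cast
    ring
  rw [intervalIntegral.integral_eq_sub_of_hasDerivAt (fun t _ => h t)
    (Continuous.intervalIntegrable (by fun_prop) _ _)]
  ring

/-- Integration over the unit interval of a continuous function given piecewise on `[0, x]` and
`[x, 1]`. -/
lemma integral_split_unit {f g h : ℝ → ℝ} (hf : Continuous f) {x : ℝ}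
    (hx : x ∈ Set.Icc (0 : ℝ) 1) (hg : ∀ t ≤ x, f t = g t)
    (hh : ∀ t, x ≤ t → f t = h t) :
    ∫ t in (0 : ℝ)..1, f t = (∫ t in (0 : ℝ)..x, g t) + ∫ t in x..1, h t := by
  rw [← intervalIntegral.integral_add_adjacent_intervals (hf.intervalIntegrable 0 x)
    (hf.intervalIntegrable x 1)]
  congr 1
  · refine intervalIntegral.integral_congr fun t ht => hg t ?_
    rw [Set.uIcc_of_le hx.1] at ht
    exact ht.2
  · refine intervalIntegral.integral_congr fun t ht => hh t ?_
    rw [Set.uIcc_of_le hx.2] at ht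
    exact ht.1

lemma integral_min {x : ℝ} (hx : x ∈ Set.Icc (0 : ℝ) 1) :
    ∫ t in (0 : ℝ)..1, min x t = x - x ^ 2 / 2 := by
  rw [integral_split_unit (g := fun t => t) (h := fun _ => x) (by fun_prop) hx
    (fun t ht => min_eq_right ht) (fun t ht => min_eq_left ht), integral_id,
    intervalIntegral.integral_const, smul_eq_mul]
  ring

lemma integral_min_zero_sub {x y : ℝ} (hx : x ∈ Set.Icc (0 : ℝ) 1) (hy : y ∈ Set.Icc (0 : ℝ) 1) :
    ∫ t in (0 : ℝ)..1, min 0 (x - y - t + 1) = -(y - min x y) ^ 2 / 2 := by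
  rcases le_total x y with h | h
  · rw [integral_split_unit (x := x - y + 1) (g := fun _ => 0)
      (h := fun t => (x - y + 1) + (-1) * t + 0 * t ^ 2 + 0 * t ^ 3) (by fun_prop)
      ⟨by linarith [hx.1, hy.2], by linarith⟩
      (fun t ht => min_eq_left (by linarith))
      (fun t ht => (min_eq_right (by linarith)).trans (by ring)), integral_cubic,
      intervalIntegral.integral_zero, min_eq_left h]
    ring
  · rw [intervalIntegral.integral_congr (g := fun _ => 0), intervalIntegral.integral_zero,
      min_eq_right h]
    · ring
    · intro t ht
      rw [Set.uIcc_of_le zero_le_one] at ht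
      exact min_eq_left (by linarith [ht.2])

lemma integral_cubeUpper_z (p q r : ℝ) {x y : ℝ} (hx : x ∈ Set.Icc (0 : ℝ) 1)
    (hy : y ∈ Set.Icc (0 : ℝ) 1) :
    ∫ z in (0 : ℝ)..1, cubeUpper p q r x y z =
      q * min x y + p * (x - x ^ 2 / 2) + (2 - r) * (min x y - min x y ^ 2 / 2) +
        r * (-(y - min x y) ^ 2 / 2) := by
  have hm : min x y ∈ Set.Icc (0 : ℝ) 1 := ⟨le_min hx.1 hy.1, (min_le_left _ _).trans hx.2⟩
  have hi {f : ℝ → ℝ} (hf : Continuous f) : IntervalIntegrable f volume 0 1 :=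
    hf.intervalIntegrable 0 1
  simp only [cubeUpper, ← min_assoc]
  rw [intervalIntegral.integral_add (hi (by fun_prop)) (hi (by fun_prop)),
    intervalIntegral.integral_add (hi (by fun_prop)) (hi (by fun_prop)),
    intervalIntegral.integral_add (hi (by fun_prop)) (hi (by fun_prop))]
  simp only [intervalIntegral.integral_const_mul, intervalIntegral.integral_const, integral_min hx,
    integral_min hm, integral_min_zero_sub hx hy]
  simp

lemma integral_cubeUpper_yz (p q r : ℝ) {x : ℝ} (hx : x ∈ Set.Icc (0 : ℝ) 1) :
    ∫ y in (0 : ℝ)..1, ∫ z in (0 : ℝ)..1, cubeUpper p q r x y z =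
      (p + q) * (x - x ^ 2 / 2) + (2 - r) * (x - x ^ 2 + x ^ 3 / 3) - r * (1 - x) ^ 3 / 6 := by
  rw [intervalIntegral.integral_congr (g := fun y => q * min x y + p * (x - x ^ 2 / 2) +
      (2 - r) * (min x y - min x y ^ 2 / 2) + r * (-(y - min x y) ^ 2 / 2))]
  · rw [integral_split_unit (x := x)
      (g := fun t => p * (x - x ^ 2 / 2) + (q + (2 - r)) * t + (-(2 - r) / 2) * t ^ 2 + 0 * t ^ 3)
      (h := fun t => (q * x + p * (x - x ^ 2 / 2) + (2 - r) * (x - x ^ 2 / 2) - r * x ^ 2 / 2) +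
        r * x * t + (-r / 2) * t ^ 2 + 0 * t ^ 3) (by fun_prop) hx
      (fun t ht => by rw [min_eq_right ht]; ring)
      (fun t ht => by rw [min_eq_left ht]; ring), integral_cubic, integral_cubic]
    ring
  · intro y hy
    rw [Set.uIcc_of_le zero_le_one] at hy
    exact integral_cubeUpper_z p q r hx hy

lemma continuous_cubeUpper (p q r : ℝ) :
    Continuous fun v : Fin 3 → ℝ => cubeUpper p q r (v 0) (v 1) (v 2) := by
  unfold cubeUpper
  fun_prop

lemma continuous_cubeLower (p q r : ℝ) :
    Continuous fun v : Fin 3 → ℝ => cubeLower p q r (v 0) (v 1) (v 2) := by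
  unfold cubeLower cubeUpper
  fun_prop

lemma integral_cubeUpper (p q r : ℝ) :
    ∫ x in (0 : ℝ)..1, ∫ y in (0 : ℝ)..1, ∫ z in (0 : ℝ)..1, cubeUpper p q r x y z =
      (p + q) / 3 + (2 - r) / 4 - r / 24 := by
  rw [intervalIntegral.integral_congr (g := fun x => -r / 6 + (p + q + (2 - r) + r / 2) * x +
    (-(p + q) / 2 - (2 - r) - r / 2) * x ^ 2 + ((2 - r) / 3 + r / 6) * x ^ 3), integral_cubic]
  · ring
  · intro x hx
    rw [Set.uIcc_of_le zero_le_one] at hx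
    refine (integral_cubeUpper_yz p q r hx).trans ?_
    ring

lemma integral_cubeLower (p q r : ℝ) :
    ∫ x in (0 : ℝ)..1, ∫ y in (0 : ℝ)..1, ∫ z in (0 : ℝ)..1, cubeLower p q r x y z =
      (p + q) / 6 - r / 4 + (2 - r) / 24 := by
  have hc (x : ℝ) : Continuous fun u : ℝ × ℝ => cubeUpper p q (2 - r) (1 - x) u.1 u.2 := by
    unfold cubeUpper
    fun_prop
  have hz (x y : ℝ) : ∫ z in (0 : ℝ)..1, cubeLower p q r x y z =
      p / 2 + q * y - ∫ z in (0 : ℝ)..1, cubeUpper p q (2 - r) (1 - x) y z := by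
    have hcy : Continuous fun z => cubeUpper p q (2 - r) (1 - x) y z :=
      (hc x).comp (Continuous.prodMk_right y)
    unfold cubeLower
    rw [intervalIntegral.integral_sub (Continuous.intervalIntegrable (by fun_prop) _ _)
      (hcy.intervalIntegrable _ _), intervalIntegral.integral_congr
      (g := fun z => q * y + p * z + 0 * z ^ 2 + 0 * z ^ 3) fun z _ => by ring, integral_cubic]
    ring
  have hy (x : ℝ) : ∫ y in (0 : ℝ)..1, ∫ z in (0 : ℝ)..1, cubeLower p q r x y z =
      (p + q) / 2 -
        ∫ y in (0 : ℝ)..1, ∫ z in (0 : ℝ)..1, cubeUpper p q (2 - r) (1 - x) y z := by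
    have hcx : Continuous fun y => ∫ z in (0 : ℝ)..1, cubeUpper p q (2 - r) (1 - x) y z :=
      intervalIntegral.continuous_parametric_intervalIntegral_of_continuous' (hc x) 0 1
    simp_rw [hz]
    rw [intervalIntegral.integral_sub (Continuous.intervalIntegrable (by fun_prop) _ _)
      (hcx.intervalIntegrable _ _), intervalIntegral.integral_congr
      (g := fun y => p / 2 + q * y + 0 * y ^ 2 + 0 * y ^ 3) fun y _ => by ring, integral_cubic]
    ring
  simp_rw [hy]
  rw [intervalIntegral.integral_congr (g := fun x => -r / 3 + 0 * x + (p + q) / 2 * x ^ 2 +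
    (r / 3 + (2 - r) / 6) * x ^ 3), integral_cubic]
  · ring
  · intro x hx
    rw [Set.uIcc_of_le zero_le_one] at hx
    refine (congrArg _ (integral_cubeUpper_yz p q (2 - r)
      ⟨sub_nonneg.2 hx.2, sub_le_self 1 hx.1⟩)).trans ?_
    ring

lemma volume_cubeRegion {p q r : ℝ} (hp : 0 ≤ p) (hq : 0 ≤ q) (hr : 0 ≤ r) (hr' : r ≤ 2) :
    volume (cubeRegion p q r) = ENNReal.ofReal ((p + q) / 6 + 5 / 12) := by
  let U : (Fin 3 → ℝ) → ℝ := fun v => cubeUpper p q r (v 0) (v 1) (v 2)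
  let L : (Fin 3 → ℝ) → ℝ := fun v => cubeLower p q r (v 0) (v 1) (v 2)
  have hU : Continuous U := continuous_cubeUpper p q r
  have hL : Continuous L := continuous_cubeLower p q r
  let T : Set (ℝ × (Fin 3 → ℝ)) := {u | u.2 ∈ Set.Icc 0 1 ∧ u.1 ∈ Set.Icc (L u.2) (U u.2)}
  have hT : MeasurableSet T := by
    refine (isClosed_Icc.preimage continuous_snd).measurableSet.inter ?_
    exact ((isClosed_le (hL.comp continuous_snd) continuous_fst).inter
      (isClosed_le continuous_fst (hU.comp continuous_snd))).measurableSet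
  have e := volume_preserving_piFinSuccAbove (fun _ : Fin 4 => ℝ) 0
  have hpre : cubeRegion p q r =
      MeasurableEquiv.piFinSuccAbove (fun _ : Fin 4 => ℝ) 0 ⁻¹' T := by
    ext v
    simp [T, L, U, cubeRegion, MeasurableEquiv.piFinSuccAbove, Fin.insertNthEquiv, Pi.le_def,
      Fin.forall_fin_succ]
    tauto
  have hsec (w : Fin 3 → ℝ) : volume ((fun z => (z, w)) ⁻¹' T) =
      (Set.Icc 0 1).indicator (fun w => ENNReal.ofReal (U w - L w)) w := by
    by_cases hw : w ∈ Set.Icc 0 1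
    · rw [Set.indicator_of_mem hw, ← Real.volume_Icc]
      congr 1
      ext z
      exact and_iff_right hw
    · rw [Set.indicator_of_notMem hw, ← measure_empty (μ := (volume : Measure ℝ))]
      congr 1
      ext z
      exact iff_of_false (fun h => hw h.1) (Set.notMem_empty z)
  have hUi : IntegrableOn U (Set.Icc 0 1) := hU.continuousOn.integrableOn_compact isCompact_Icc
  have hLi : IntegrableOn L (Set.Icc 0 1) := hL.continuousOn.integrableOn_compact isCompact_Icc
  have hLU : ∀ w ∈ Set.Icc (0 : Fin 3 → ℝ) 1, L w ≤ U w := fun w hw =>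
    have h (i : Fin 3) : w i ∈ Set.Icc (0 : ℝ) 1 := ⟨hw.1 i, hw.2 i⟩
    (cubeLower_le_cubeMonomial hp hq hr hr' (h 0) (h 1) (h 2)).trans
      (cubeMonomial_le_cubeUpper hp hq hr hr' (h 0) (h 1) (h 2))
  rw [hpre, e.measure_preimage_equiv, Measure.volume_eq_prod, Measure.prod_apply_symm hT]
  simp_rw [hsec]
  rw [lintegral_indicator measurableSet_Icc,
    ← ofReal_integral_eq_lintegral_ofReal (f := fun w => U w - L w) (hUi.sub hLi)
    ((ae_restrict_iff' measurableSet_Icc).2 (.of_forall fun w hw => sub_nonneg.2 (hLU w hw)))]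
  congr 1
  rw [integral_sub hUi hLi, setIntegral_cube_three hU, setIntegral_cube_three hL]
  refine (congrArg₂ _ (integral_cubeUpper p q r) (integral_cubeLower p q r)).trans ?_
  ring

open scoped Pointwise in
lemma volume_PH_eq (c₁ c₂ c₃ ℓ₁ ℓ₂ ℓ₃ : ℝ) (hℓ₁ : 0 < ℓ₁) (hℓ₂ : 0 < ℓ₂) (hℓ₃ : 0 < ℓ₃) :
    volume (PH c₁ c₂ c₃ ℓ₁ ℓ₂ ℓ₃) = ENNReal.ofReal (32 * ℓ₁ ^ 2 * ℓ₂ ^ 2 * ℓ₃ ^ 2) *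
      volume (convexHull ℝ (cubeGraph (c₂ / ℓ₂ - 1) (c₃ / ℓ₃ - 1) (1 - c₁ / ℓ₁))) := by
  obtain ⟨a₁, h₁⟩ : ∃ a, a = c₁ - ℓ₁ := ⟨_, rfl⟩
  obtain ⟨a₂, h₂⟩ : ∃ a, a = c₂ - ℓ₂ := ⟨_, rfl⟩
  obtain ⟨a₃, h₃⟩ : ∃ a, a = c₃ - ℓ₃ := ⟨_, rfl⟩
  let M : Matrix (Fin 4) (Fin 4) ℝ :=
    !![4 * ℓ₁ * ℓ₂ * ℓ₃, 2 * ℓ₁ * a₂ * a₃, 2 * ℓ₂ * a₁ * a₃, 2 * ℓ₃ * a₁ * a₂;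
       0, 2 * ℓ₁, 0, 0;
       0, 0, 2 * ℓ₂, 0;
       0, 0, 0, 2 * ℓ₃]
  have hdet : LinearMap.det (Matrix.toLin' M) = 32 * ℓ₁ ^ 2 * ℓ₂ ^ 2 * ℓ₃ ^ 2 := by
    rw [LinearMap.det_toLin', Matrix.det_succ_column_zero]
    simp [M, Fin.sum_univ_succ, Matrix.det_fin_three]
    ring
  have himage (x y z : ℝ) : ![a₁ * a₂ * a₃, a₁, a₂, a₃] +ᵥ Matrix.toLin' M
      ![cubeMonomial (c₂ / ℓ₂ - 1) (c₃ / ℓ₃ - 1) (1 - c₁ / ℓ₁) x y z, x, y, z] =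
      ![(a₁ + 2 * ℓ₁ * x) * (a₂ + 2 * ℓ₂ * y) * (a₃ + 2 * ℓ₃ * z),
        a₁ + 2 * ℓ₁ * x, a₂ + 2 * ℓ₂ * y, a₃ + 2 * ℓ₃ * z] := by
    ext i
    fin_cases i
    · simp [M, cubeMonomial, h₁, h₂, h₃]
      field_simp
      ring
    all_goals simp [M, mul_comm]
  have hgraph : {p : Fin 4 → ℝ | ∃ x₁ x₂ x₃ : ℝ,
      x₁ ∈ Set.Icc (c₁ - ℓ₁) (c₁ + ℓ₁) ∧ x₂ ∈ Set.Icc (c₂ - ℓ₂) (c₂ + ℓ₂) ∧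
      x₃ ∈ Set.Icc (c₃ - ℓ₃) (c₃ + ℓ₃) ∧ p = ![x₁ * x₂ * x₃, x₁, x₂, x₃]} =
      ![a₁ * a₂ * a₃, a₁, a₂, a₃] +ᵥ (Matrix.toLin' M ''
        cubeGraph (c₂ / ℓ₂ - 1) (c₃ / ℓ₃ - 1) (1 - c₁ / ℓ₁)) := by
    have hout {a c ℓ x : ℝ} (h : a = c - ℓ) (hℓ : 0 < ℓ) (hx : x ∈ Set.Icc (c - ℓ) (c + ℓ)) :
        (x - a) / (2 * ℓ) ∈ Set.Icc (0 : ℝ) 1 := by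
      rw [Set.mem_Icc, le_div_iff₀ (by positivity), div_le_iff₀ (by positivity)]
      constructor <;> linarith [hx.1, hx.2]
    have hin {a c ℓ x : ℝ} (h : a = c - ℓ) (hℓ : 0 < ℓ) (hx : x ∈ Set.Icc (0 : ℝ) 1) :
        a + 2 * ℓ * x ∈ Set.Icc (c - ℓ) (c + ℓ) := by
      constructor <;> nlinarith [hx.1, hx.2]
    have hinv {a ℓ x : ℝ} (hℓ : 0 < ℓ) : a + 2 * ℓ * ((x - a) / (2 * ℓ)) = x := by
      field_simp
      ring
    ext v
    constructor
    · rintro ⟨x, y, z, hx, hy, hz, rfl⟩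
      refine Set.mem_vadd_set.2 ⟨_, ⟨_, ⟨_, _, _, hout h₁ hℓ₁ hx, hout h₂ hℓ₂ hy,
        hout h₃ hℓ₃ hz, rfl⟩, rfl⟩, ?_⟩
      rw [himage, hinv hℓ₁, hinv hℓ₂, hinv hℓ₃]
    · rintro ⟨_, ⟨_, ⟨x, y, z, hx, hy, hz, rfl⟩, rfl⟩, rfl⟩
      exact ⟨_, _, _, hin h₁ hℓ₁ hx, hin h₂ hℓ₂ hy, hin h₃ hℓ₃ hz, himage x y z⟩
  rw [PH, hgraph, convexHull_vadd, measure_vadd, ← LinearMap.image_convexHull,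
    Measure.addHaar_image_linearMap, hdet, abs_of_pos (by positivity)]

theorem volume_PH_case2 (c₁ c₂ c₃ ℓ₁ ℓ₂ ℓ₃ : ℝ)
    (hc₁ : 0 ≤ c₁) (hc₂ : 0 ≤ c₂) (hc₃ : 0 ≤ c₃)
    (hℓ₁ : 0 < ℓ₁) (hℓ₂ : 0 < ℓ₂) (hℓ₃ : 0 < ℓ₃)
    (hΩ₁ : c₁ / ℓ₁ ≤ c₂ / ℓ₂) (hΩ₂ : c₂ / ℓ₂ ≤ c₃ / ℓ₃)
    (h₁ : c₁ / ℓ₁ < 1) (h₂ : 1 ≤ c₂ / ℓ₂) :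
    volume (PH c₁ c₂ c₃ ℓ₁ ℓ₂ ℓ₃) =
      ENNReal.ofReal (8 / 3 * ℓ₁ ^ 2 * ℓ₂ ^ 2 * ℓ₃ ^ 2 *
        (2 * (c₂ / ℓ₂) + 2 * (c₃ / ℓ₃) + 1)) := by
  have hp : 0 ≤ c₂ / ℓ₂ - 1 := sub_nonneg.2 h₂
  have hq : 0 ≤ c₃ / ℓ₃ - 1 := sub_nonneg.2 (h₂.trans hΩ₂)
  have hr : 0 ≤ 1 - c₁ / ℓ₁ := sub_nonneg.2 h₁.le
  have hr' : 1 - c₁ / ℓ₁ ≤ 2 := by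
    have : 0 ≤ c₁ / ℓ₁ := by positivity
    linarith
  rw [volume_PH_eq _ _ _ _ _ _ hℓ₁ hℓ₂ hℓ₃, convexHull_cubeGraph hp hq hr hr',
    volume_cubeRegion hp hq hr hr', ← ENNReal.ofReal_mul (by positivity)]
  congr 1
  ring
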